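/- arXiv:1409.1632 — 2 statements merged into one kernel-verified Lean document; each statement's English description precedes it below -/
import Mathlib

section
/- Let f₁, …, f_m : D̄ → ℂ be C¹ functions on the closed unit disk satisfying the first-order elliptic system ∂f_j/∂z̄ + Σ_k a_{kj} f_k = 0 on D with smooth coefficients a_{kj}, and f_j = 0 on ∂D for all j. Then f_j ≡ 0 on D for all j. -/
open Metric

/-- The Wirtinger derivative `∂_z̄ f = (f_x + i f_y)/2`. -/
noncomputable def wdzbar {E : Type*} [NormedAddCommGroup E] [NormedSpace ℂ E]
    (f : ℂ → E) (z : ℂ) : E :=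
  (1 / 2 : ℂ) • (fderiv ℝ f z 1 + Complex.I • fderiv ℝ f z Complex.I)

open MeasureTheory Filter Topology

section WeightedEstimate

/-- A function vanishing outside the open unit ball has compact support. -/
theorem hasCompactSupport_of_eq_zero_off_ball {g : ℂ → ℝ} (h : ∀ z, 1 ≤ ‖z‖ → g z = 0) :
    HasCompactSupport g :=
  HasCompactSupport.intro (isCompact_closedBall (0 : ℂ) 1) fun z hz =>
    h z (by simpa using (not_le.1 (by simpa using hz)).le)

/-- Bounded measurable functions vanishing outside the closed unit disk. -/
structure IsBoundedOnDisk (g : ℂ → ℝ) : Prop where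
  measurable : Measurable g
  bounded : ∃ C, ∀ z, |g z| ≤ C
  eq_zero : ∀ z, 1 < ‖z‖ → g z = 0

theorem IsBoundedOnDisk.integrable {g : ℂ → ℝ} (h : IsBoundedOnDisk g) : Integrable g := by
  obtain ⟨C, hC⟩ := h.bounded
  have h1 : IntegrableOn g (closedBall 0 1) :=
    Measure.integrableOn_of_bounded (M := C) (isCompact_closedBall (0 : ℂ) 1).measure_lt_top.ne
      h.measurable.aestronglyMeasurable (Eventually.of_forall hC)
  refine (integrableOn_iff_integrable_of_support_subset ?_).1 h1
  intro z hz
  by_contra hz'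
  exact hz (h.eq_zero z (by simpa using hz'))

theorem IsBoundedOnDisk.add {g h : ℂ → ℝ} (hg : IsBoundedOnDisk g) (hh : IsBoundedOnDisk h) :
    IsBoundedOnDisk fun z => g z + h z := by
  obtain ⟨C, hC⟩ := hg.bounded
  obtain ⟨D, hD⟩ := hh.bounded
  exact ⟨hg.measurable.add hh.measurable,
    ⟨C + D, fun z => (abs_add_le _ _).trans (add_le_add (hC z) (hD z))⟩,
    fun z hz => by simp [hg.eq_zero z hz, hh.eq_zero z hz]⟩

theorem IsBoundedOnDisk.continuous_mul {g c : ℂ → ℝ} (hg : IsBoundedOnDisk g)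
    (hc : Continuous c) : IsBoundedOnDisk fun z => c z * g z := by
  obtain ⟨C, hC⟩ := hg.bounded
  obtain ⟨K, hK⟩ := (isCompact_closedBall (0 : ℂ) 1).exists_bound_of_continuousOn hc.continuousOn
  have hC0 : 0 ≤ C := (abs_nonneg _).trans (hC 0)
  have hK0 : 0 ≤ K := (norm_nonneg _).trans (hK 0 (by simp))
  refine ⟨hc.measurable.mul hg.measurable, ⟨K * C, fun z => ?_⟩,
    fun z hz => by simp [hg.eq_zero z hz]⟩
  rcases le_or_gt ‖z‖ 1 with hz | hz
  · rw [abs_mul]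
    exact mul_le_mul (hK z (by simpa using hz)) (hC z) (abs_nonneg _) hK0
  · simpa [hg.eq_zero z hz] using mul_nonneg hK0 hC0

theorem IsBoundedOnDisk.const_mul {g : ℂ → ℝ} (hg : IsBoundedOnDisk g) (c : ℝ) :
    IsBoundedOnDisk fun z => c * g z :=
  hg.continuous_mul continuous_const

theorem IsBoundedOnDisk.sub {g h : ℂ → ℝ} (hg : IsBoundedOnDisk g) (hh : IsBoundedOnDisk h) :
    IsBoundedOnDisk fun z => g z - h z := by
  simpa [sub_eq_add_neg] using hg.add (hh.const_mul (-1))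

theorem IsBoundedOnDisk.mul {g h : ℂ → ℝ} (hg : IsBoundedOnDisk g) (hh : IsBoundedOnDisk h) :
    IsBoundedOnDisk fun z => g z * h z := by
  obtain ⟨C, hC⟩ := hg.bounded
  obtain ⟨D, hD⟩ := hh.bounded
  refine ⟨hg.measurable.mul hh.measurable, ⟨C * D, fun z => ?_⟩,
    fun z hz => by simp [hg.eq_zero z hz]⟩
  rw [abs_mul]
  exact mul_le_mul (hC z) (hD z) (abs_nonneg _) ((abs_nonneg _).trans (hC z))

theorem LipschitzWith.isBoundedOnDisk {C : NNReal} {p : ℂ → ℝ} (hp : LipschitzWith C p)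
    (hp0 : ∀ z, 1 ≤ ‖z‖ → p z = 0) : IsBoundedOnDisk p :=
  ⟨hp.continuous.measurable,
    (hasCompactSupport_of_eq_zero_off_ball hp0).exists_bound_of_continuous hp.continuous,
    fun z hz => hp0 z hz.le⟩

theorem lineDeriv_eq_zero_off_closedBall {p : ℂ → ℝ} (hp0 : ∀ z, 1 ≤ ‖z‖ → p z = 0) {z : ℂ}
    (hz : 1 < ‖z‖) (v : ℂ) : lineDeriv ℝ p z v = 0 := by
  have h : p =ᶠ[𝓝 z] fun _ => 0 := by
    filter_upwards [(isOpen_lt continuous_const continuous_norm).mem_nhds hz] with w hw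
    exact hp0 w (le_of_lt hw)
  rw [h.lineDeriv_eq]
  exact (hasFDerivAt_const (0 : ℝ) z).hasLineDerivAt v |>.lineDeriv

theorem LipschitzWith.isBoundedOnDisk_lineDeriv {C : NNReal} {p : ℂ → ℝ} (hp : LipschitzWith C p)
    (hp0 : ∀ z, 1 ≤ ‖z‖ → p z = 0) (v : ℂ) : IsBoundedOnDisk fun z => lineDeriv ℝ p z v :=
  ⟨measurable_lineDeriv hp.continuous,
    ⟨C * ‖v‖, fun _ => norm_lineDeriv_le_of_lipschitz ℝ hp⟩,
    fun _ hz => lineDeriv_eq_zero_off_closedBall hp0 hz v⟩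

/-- The Jacobian of a pair of compactly supported Lipschitz functions has integral zero. -/
theorem integral_lineDeriv_mul_lineDeriv_comm {C D : NNReal} {p q : ℂ → ℝ}
    (hp : LipschitzWith C p) (hp0 : ∀ z, 1 ≤ ‖z‖ → p z = 0)
    (hq : LipschitzWith D q) (hq0 : ∀ z, 1 ≤ ‖z‖ → q z = 0) (v w : ℂ) :
    ∫ z, lineDeriv ℝ p z v * lineDeriv ℝ q z w = ∫ z, lineDeriv ℝ p z w * lineDeriv ℝ q z v := by
  have hpw := hp.isBoundedOnDisk_lineDeriv hp0 w
  have hqw := hq.isBoundedOnDisk_lineDeriv hq0 w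
  have h1 := hp.integral_inv_smul_sub_mul_tendsto_integral_lineDeriv_mul hqw.integrable v
  have h2 := hq.integral_inv_smul_sub_mul_tendsto_integral_lineDeriv_mul hpw.integrable (-v)
  have key : ∀ t : ℝ, ∫ z, (t⁻¹ • (p (z + t • v) - p z)) * lineDeriv ℝ q z w
      = -∫ z, (t⁻¹ • (q (z + t • -v) - q z)) * lineDeriv ℝ p z w := by
    intro t
    have hcp := hasCompactSupport_of_eq_zero_off_ball hp0
    have hpt : LipschitzWith C fun z => p (z + t • v) :=
      LipschitzWith.of_dist_le_mul fun x y => by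
        simpa using hp.dist_le_mul (x + t • v) (y + t • v)
    have hcpt : HasCompactSupport fun z => p (z + t • v) :=
      hcp.comp_homeomorph (Homeomorph.addRight (t • v))
    have hqt : Continuous fun z => q (z + t • -v) := hq.continuous.comp (by fun_prop)
    have e1 := hq.integral_lineDeriv_mul_eq (μ := volume) hpt hcpt w
    have e2 := hq.integral_lineDeriv_mul_eq (μ := volume) hp hcp w
    have e3 : ∫ z, lineDeriv ℝ (fun z => p (z + t • v)) z (-w) * q z
        = ∫ z, lineDeriv ℝ p z (-w) * q (z + t • -v) := by
      rw [← integral_add_right_eq_self (fun z => lineDeriv ℝ p z (-w) * q (z + t • -v)) (t • v)]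
      refine integral_congr_ae (Eventually.of_forall fun z => ?_)
      have : lineDeriv ℝ (fun z => p (z + t • v)) z (-w) = lineDeriv ℝ p (z + t • v) (-w) := by
        simp only [lineDeriv]
        congr 1
        ext r
        congr 1
        ring
      simp only [this, smul_neg, add_neg_cancel_right]
    have i1 : Integrable fun z => lineDeriv ℝ q z w * p (z + t • v) := by
      simpa [mul_comm] using (hqw.continuous_mul hpt.continuous).integrable
    have i2 : Integrable fun z => lineDeriv ℝ q z w * p z :=
      (hqw.mul (hp.isBoundedOnDisk hp0)).integrable
    have i3 : Integrable fun z => lineDeriv ℝ p z w * q (z + t • -v) := by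
      simpa [mul_comm] using (hpw.continuous_mul hqt).integrable
    have i4 : Integrable fun z => lineDeriv ℝ p z w * q z :=
      (hpw.mul (hq.isBoundedOnDisk hq0)).integrable
    rw [e3] at e1
    simp only [lineDeriv_neg, neg_mul, integral_neg] at e1 e2
    calc _ = t⁻¹ * ((∫ z, lineDeriv ℝ q z w * p (z + t • v)) - ∫ z, lineDeriv ℝ q z w * p z) := by
            rw [← integral_sub i1 i2, ← integral_const_mul]
            congr 1; ext z; simp only [smul_eq_mul]; ring
      _ = -(t⁻¹ * ((∫ z, lineDeriv ℝ p z w * q (z + t • -v))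
            - ∫ z, lineDeriv ℝ p z w * q z)) := by
            rw [e1, e2]; ring
      _ = _ := by
            rw [← integral_sub i3 i4, ← integral_const_mul]
            congr 2; ext z; simp only [smul_eq_mul]; ring
  simp only [key] at h1
  have h3 := tendsto_nhds_unique h1 h2.neg
  rw [h3, ← integral_neg]
  congr 1; ext z
  rw [lineDeriv_neg]; ring

/-- Integration by parts of `p ∂_v p` against a linear function. -/
theorem integral_linear_mul_self_mul_lineDeriv {C : NNReal} {p : ℂ → ℝ}
    (hp : LipschitzWith C p) (hp0 : ∀ z, 1 ≤ ‖z‖ → p z = 0) (L : ℂ →L[ℝ] ℝ) (v : ℂ) :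
    ∫ z, L z * (p z * lineDeriv ℝ p z v) = -(L v / 2) * ∫ z, p z * p z := by
  obtain ⟨M, hM⟩ := (hp.isBoundedOnDisk hp0).bounded
  have hM0 : 0 ≤ M := (abs_nonneg _).trans (hM 0)
  have hpp : LipschitzWith (2 * M.toNNReal * C) fun z => p z * p z := by
    refine LipschitzWith.of_dist_le_mul fun x y => ?_
    have h1 := hp.dist_le_mul x y
    rw [Real.dist_eq] at h1 ⊢
    have h2 : |p x + p y| ≤ 2 * M := (abs_add_le _ _).trans (by linarith [hM x, hM y])
    calc |p x * p x - p y * p y| = |p x + p y| * |p x - p y| := by rw [← abs_mul]; ring_nf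
      _ ≤ (2 * M) * (C * dist x y) := mul_le_mul h2 h1 (abs_nonneg _) (by positivity)
      _ = _ := by push_cast; rw [Real.coe_toNNReal _ hM0]; ring
  have hcpp := hasCompactSupport_of_eq_zero_off_ball (g := fun z => p z * p z)
    fun z hz => by simp [hp0 z hz]
  have h := L.lipschitz.integral_lineDeriv_mul_eq (μ := volume) hpp hcpp v
  have hL : ∀ z, lineDeriv ℝ (fun z => L z) z v = L v := fun z =>
    (L.hasFDerivAt.hasLineDerivAt v).lineDeriv
  simp only [hL, integral_const_mul] at h
  have h2 : ∫ z, lineDeriv ℝ (fun z => p z * p z) z (-v) * L z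
      = -2 * ∫ z, L z * (p z * lineDeriv ℝ p z v) := by
    rw [← integral_const_mul]
    refine integral_congr_ae ?_
    filter_upwards [hp.ae_lineDifferentiableAt (μ := volume) v] with z hz
    have hd : HasDerivAt (fun t : ℝ => p (z + t • v)) (lineDeriv ℝ p z v) 0 := hz.hasLineDerivAt
    have hd2 : lineDeriv ℝ (fun z => p z * p z) z v = 2 * (p z * lineDeriv ℝ p z v) := by
      refine (hd.mul hd).deriv.trans ?_
      simp only [zero_smul, add_zero]; ring
    rw [lineDeriv_neg, hd2]; ring
  rw [h2] at h
  linarith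

/-- A Carleman estimate for `∂_z̄` with weight `|z|²`, for `v = p + i q`. -/
theorem integral_sq_le_integral_conjugated_dzbar {C D : NNReal} {p q : ℂ → ℝ}
    (hp : LipschitzWith C p) (hp0 : ∀ z, 1 ≤ ‖z‖ → p z = 0)
    (hq : LipschitzWith D q) (hq0 : ∀ z, 1 ≤ ‖z‖ → q z = 0) (s : ℝ) {G : ℂ → ℝ}
    (hG : Integrable G)
    (h : ∀ᵐ z, (lineDeriv ℝ p z 1 - lineDeriv ℝ q z Complex.I
        - 2 * s * (z.re * p z - z.im * q z)) ^ 2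
      + (lineDeriv ℝ q z 1 + lineDeriv ℝ p z Complex.I
        - 2 * s * (z.re * q z + z.im * p z)) ^ 2 ≤ G z) :
    8 * s * ∫ z, (p z * p z + q z * q z) ≤ ∫ z, G z := by
  have bp := hp.isBoundedOnDisk hp0
  have bq := hq.isBoundedOnDisk hq0
  have bdp := hp.isBoundedOnDisk_lineDeriv hp0
  have bdq := hq.isBoundedOnDisk_lineDeriv hq0
  have j1 := ((bdp 1).mul (bdq Complex.I)).integrable
  have j2 := ((bdp Complex.I).mul (bdq 1)).integrable
  have k1 := ((bp.mul (bdp 1)).continuous_mul Complex.reCLM.continuous).integrable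
  have k2 := ((bq.mul (bdq 1)).continuous_mul Complex.reCLM.continuous).integrable
  have k3 := ((bp.mul (bdp Complex.I)).continuous_mul Complex.imCLM.continuous).integrable
  have k4 := ((bq.mul (bdq Complex.I)).continuous_mul Complex.imCLM.continuous).integrable
  have hJ := integral_lineDeriv_mul_lineDeriv_comm hp hp0 hq hq0 1 Complex.I
  have hk1 := integral_linear_mul_self_mul_lineDeriv hp hp0 Complex.reCLM 1
  have hk2 := integral_linear_mul_self_mul_lineDeriv hq hq0 Complex.reCLM 1
  have hk3 := integral_linear_mul_self_mul_lineDeriv hp hp0 Complex.imCLM Complex.I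
  have hk4 := integral_linear_mul_self_mul_lineDeriv hq hq0 Complex.imCLM Complex.I
  have hle := integral_mono_ae
    (((j1.sub j2).const_mul (-4)).add ((((k1.add k2).add k3).add k4).const_mul (-8 * s))) hG
    (h.mono fun z hz => le_trans (by
      simp only [Pi.add_apply, Pi.sub_apply, Complex.reCLM_apply, Complex.imCLM_apply]
      nlinarith [sq_nonneg (lineDeriv ℝ p z 1 + lineDeriv ℝ q z Complex.I
          + 2 * s * (z.re * p z + z.im * q z)),
        sq_nonneg (lineDeriv ℝ q z 1 - lineDeriv ℝ p z Complex.I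
          + 2 * s * (z.re * q z - z.im * p z))]) hz)
  rw [integral_add' ((j1.sub j2).const_mul (-4))
      ((((k1.add k2).add k3).add k4).const_mul (-8 * s)), integral_const_mul, integral_const_mul,
    integral_sub' j1 j2, integral_add' ((k1.add k2).add k3) k4, integral_add' (k1.add k2) k3,
    integral_add' k1 k2, hJ, hk1, hk2, hk3, hk4] at hle
  rw [integral_add (bp.mul bp).integrable (bq.mul bq).integrable]
  simp only [Complex.reCLM_apply, Complex.imCLM_apply, Complex.one_re, Complex.I_im] at hle
  linarith

end WeightedEstimate

/-- The extension by zero of a `C¹` function on the closed disk vanishing on the circle is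
Lipschitz. -/
theorem exists_lipschitzWith_indicator_ball {E : Type*} [NormedAddCommGroup E]
    [NormedSpace ℝ E] {u : ℂ → E} (hu : ContDiffOn ℝ 1 u (closedBall 0 1))
    (h0 : ∀ z : ℂ, ‖z‖ = 1 → u z = 0) : ∃ C, LipschitzWith C ((ball (0 : ℂ) 1).indicator u) := by
  obtain ⟨C, hC⟩ := hu.exists_lipschitzOnWith one_ne_zero (convex_closedBall _ _)
    (isCompact_closedBall _ _)
  refine ⟨C, LipschitzWith.of_dist_le_mul ?_⟩
  have hout : ∀ x y : ℂ, ‖x‖ < 1 → 1 ≤ ‖y‖ → dist (u x) 0 ≤ C * dist x y := by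
    intro x y hx hy
    obtain ⟨w, hw, hxw⟩ : ∃ w : ℂ, ‖w‖ = 1 ∧ dist x w ≤ 1 - ‖x‖ := by
      rcases eq_or_ne x 0 with rfl | hx0
      · exact ⟨1, by simp, by simp⟩
      · have hn : (0 : ℝ) < ‖x‖ := norm_pos_iff.2 hx0
        refine ⟨(‖x‖⁻¹ : ℝ) • x, by rw [norm_smul]; simp [hn.ne'], le_of_eq ?_⟩
        have h1 : x - (‖x‖⁻¹ : ℝ) • x = (1 - ‖x‖⁻¹ : ℝ) • x := by rw [sub_smul, one_smul]
        have h2 : 1 - ‖x‖⁻¹ ≤ 0 := by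
          have := one_le_inv_iff₀.2 ⟨hn, hx.le⟩
          linarith
        rw [dist_eq_norm, h1, norm_smul, Real.norm_eq_abs, abs_of_nonpos h2]
        field_simp
        ring
    have h1 := hC.dist_le_mul x (by simpa using hx.le) w (by simp [hw])
    rw [h0 w hw] at h1
    refine h1.trans (mul_le_mul_of_nonneg_left ?_ C.coe_nonneg)
    have h2 := norm_sub_norm_le y x
    rw [dist_comm x y, dist_eq_norm y x]
    linarith
  intro x y
  by_cases hx : ‖x‖ < 1 <;> by_cases hy : ‖y‖ < 1
  · rw [Set.indicator_of_mem (by simpa using hx), Set.indicator_of_mem (by simpa using hy)]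
    exact hC.dist_le_mul x (by simpa using hx.le) y (by simpa using hy.le)
  · rw [Set.indicator_of_mem (by simpa using hx), Set.indicator_of_notMem (by simpa using hy)]
    exact hout x y hx (not_lt.1 hy)
  · rw [Set.indicator_of_notMem (by simpa using hx), Set.indicator_of_mem (by simpa using hy),
      dist_comm, dist_comm x y]
    exact hout y x hy (not_lt.1 hx)
  · rw [Set.indicator_of_notMem (by simpa using hx), Set.indicator_of_notMem (by simpa using hy),
      dist_self]
    positivity

theorem lineDeriv_indicator_ball_exp_smul {f : ℂ → ℂ} {z : ℂ} (hz : z ∈ ball (0 : ℂ) 1)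
    (hf : DifferentiableAt ℝ f z) (s : ℝ) (L : ℂ →L[ℝ] ℝ) (w : ℂ) :
    lineDeriv ℝ (fun z => L ((ball (0 : ℂ) 1).indicator
      (fun z => Real.exp (s * (z.re * z.re + z.im * z.im)) • f z) z)) z w
      = Real.exp (s * (z.re * z.re + z.im * z.im))
        * (L (fderiv ℝ f z w) + 2 * s * (z.re * w.re + z.im * w.im) * L (f z)) := by
  have he : (fun z => L ((ball (0 : ℂ) 1).indicator
      (fun z => Real.exp (s * (z.re * z.re + z.im * z.im)) • f z) z))
      =ᶠ[𝓝 z] fun z => L (Real.exp (s * (z.re * z.re + z.im * z.im)) • f z) := by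
    filter_upwards [isOpen_ball.mem_nhds hz] with y hy
    rw [Set.indicator_of_mem hy]
  rw [he.lineDeriv_eq]
  have hre := Complex.reCLM.hasFDerivAt (x := z)
  have him := Complex.imCLM.hasFDerivAt (x := z)
  have hE := ((((hre.mul hre).add (him.mul him)).const_mul s).exp).smul hf.hasFDerivAt
  refine ((L.hasFDerivAt.comp z hE).hasLineDerivAt w).lineDeriv.trans ?_
  simp only [ContinuousLinearMap.comp_apply, add_apply,
    smul_apply, ContinuousLinearMap.smulRight_apply, map_add, map_smul,
    smul_eq_mul, Complex.reCLM_apply, Complex.imCLM_apply, Pi.add_apply, Pi.mul_apply]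
  ring

/-- Unique continuation with vanishing boundary values for a first-order elliptic system:
if `f₁, …, f_m` are `C¹` on the closed unit disk, satisfy
`∂f_j/∂z̄ + Σ_k a_{kj} f_k = 0` on the open disk with smooth coefficients `a_{kj}`, and
vanish on the boundary circle, then they vanish identically. -/
theorem elliptic_system_zero_boundary_zero (m : ℕ)
    (f : Fin m → ℂ → ℂ) (a : Fin m → Fin m → ℂ → ℂ)
    (hf : ∀ j, ContDiffOn ℝ 1 (f j) (closedBall 0 1))
    (ha : ∀ k j, ContDiffOn ℝ (⊤ : ℕ∞) (a k j) (closedBall 0 1))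
    (hpde : ∀ j, ∀ z ∈ ball (0 : ℂ) 1, wdzbar (f j) z + ∑ k, a k j z * f k z = 0)
    (hbd : ∀ j, ∀ z : ℂ, ‖z‖ = 1 → f j z = 0) :
    ∀ j, ∀ z ∈ ball (0 : ℂ) 1, f j z = 0 := by
  obtain ⟨K, hK0, hK⟩ : ∃ K : ℝ, 0 ≤ K ∧ ∀ k j, ∀ z ∈ ball (0 : ℂ) 1, ‖a k j z‖ ≤ K := by
    have h1 : ∀ k j, ∃ C : ℝ, 0 ≤ C ∧ ∀ z ∈ ball (0 : ℂ) 1, ‖a k j z‖ ≤ C := fun k j => by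
      obtain ⟨C, hC⟩ := (isCompact_closedBall (0 : ℂ) 1).exists_bound_of_continuousOn
        (ha k j).continuousOn
      exact ⟨C, (norm_nonneg _).trans (hC 0 (by simp)), fun z hz => hC z (ball_subset_closedBall hz)⟩
    choose C hC0 hC using h1
    refine ⟨∑ k, ∑ j, C k j, Finset.sum_nonneg fun k _ => Finset.sum_nonneg fun j _ => hC0 k j,
      fun k j z hz => (hC k j z hz).trans ?_⟩
    exact (Finset.single_le_sum (f := fun j => C k j) (fun j _ => hC0 k j)
      (Finset.mem_univ j)).trans (Finset.single_le_sum (f := fun k => ∑ j, C k j)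
        (fun k _ => Finset.sum_nonneg fun j _ => hC0 k j) (Finset.mem_univ k))
  set s : ℝ := K ^ 2 * m ^ 2 + 1 with hs
  set V : Fin m → ℂ → ℂ := fun j => (ball (0 : ℂ) 1).indicator
    fun z => Real.exp (s * (z.re * z.re + z.im * z.im)) • f j z with hV
  have hVout : ∀ j z, 1 ≤ ‖z‖ → V j z = 0 := fun j z hz =>
    Set.indicator_of_notMem (by simpa using hz) _
  have hVin : ∀ j, ∀ z ∈ ball (0 : ℂ) 1,
      V j z = Real.exp (s * (z.re * z.re + z.im * z.im)) • f j z := fun j z hz =>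
    Set.indicator_of_mem hz _
  have hVlip : ∀ j, ∃ C, LipschitzWith C (V j) := fun j => by
    have hE : ContDiff ℝ 1 fun z : ℂ => Real.exp (s * (z.re * z.re + z.im * z.im)) :=
      (contDiff_const.mul ((Complex.reCLM.contDiff.mul Complex.reCLM.contDiff).add
        (Complex.imCLM.contDiff.mul Complex.imCLM.contDiff))).exp
    exact exists_lipschitzWith_indicator_ball (hE.contDiffOn.smul (hf j))
      fun z hz => by simp [hbd j z hz]
  choose C hC using hVlip
  have hp : ∀ j, LipschitzWith _ fun z => Complex.reCLM (V j z) := fun j =>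
    Complex.reCLM.lipschitz.comp (hC j)
  have hq : ∀ j, LipschitzWith _ fun z => Complex.imCLM (V j z) := fun j =>
    Complex.imCLM.lipschitz.comp (hC j)
  have hp0 : ∀ j z, 1 ≤ ‖z‖ → Complex.reCLM (V j z) = 0 := fun j z hz => by
    rw [hVout j z hz, map_zero]
  have hq0 : ∀ j z, 1 ≤ ‖z‖ → Complex.imCLM (V j z) = 0 := fun j z hz => by
    rw [hVout j z hz, map_zero]
  set N : Fin m → ℂ → ℝ := fun j z => Complex.reCLM (V j z) * Complex.reCLM (V j z)
    + Complex.imCLM (V j z) * Complex.imCLM (V j z) with hN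
  have hNnorm : ∀ j z, N j z = ‖V j z‖ ^ 2 := fun j z => by
    rw [← Complex.normSq_eq_norm_sq, Complex.normSq_apply]; rfl
  have hNint : ∀ j, Integrable (N j) := fun j =>
    ((((hp j).isBoundedOnDisk (hp0 j)).mul ((hp j).isBoundedOnDisk (hp0 j))).add
      (((hq j).isBoundedOnDisk (hq0 j)).mul ((hq j).isBoundedOnDisk (hq0 j)))).integrable
  have hsumint : Integrable fun z => ∑ k, N k z := integrable_finsetSum _ fun k _ => hNint k
  have hineq : ∀ j, 8 * s * ∫ z, N j z ≤ ∫ z, 4 * K ^ 2 * m * ∑ k, N k z := by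
    intro j
    refine integral_sq_le_integral_conjugated_dzbar (hp j) (hp0 j) (hq j) (hq0 j) s
      (hsumint.const_mul _) ?_
    have hsphere : ∀ᵐ z : ℂ, z ∉ sphere (0 : ℂ) 1 :=
      measure_eq_zero_iff_ae_notMem.1 (Measure.addHaar_sphere _ _ _)
    filter_upwards [hsphere] with z hz
    have hRHS : 0 ≤ 4 * K ^ 2 * m * ∑ k, N k z :=
      mul_nonneg (by positivity) (Finset.sum_nonneg fun k _ => by rw [hNnorm]; positivity)
    rcases lt_trichotomy ‖z‖ 1 with hz1 | hz1 | hz1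
    · have hzb : z ∈ ball (0 : ℂ) 1 := by simpa using hz1
      have hdiff : DifferentiableAt ℝ (f j) z :=
        ((hf j).differentiableOn one_ne_zero).differentiableAt
          (mem_of_superset (isOpen_ball.mem_nhds hzb) ball_subset_closedBall)
      have hd := lineDeriv_indicator_ball_exp_smul hzb hdiff s
      have hpde' := hpde j z hzb
      set S := ∑ k, a k j z * f k z with hS
      set e := Real.exp (s * (z.re * z.re + z.im * z.im)) with he
      set d1 := fderiv ℝ (f j) z 1 with hd1
      set d2 := fderiv ℝ (f j) z Complex.I with hd2
      have hr : d1.re - d2.im = -2 * S.re := by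
        have := congrArg Complex.re hpde'
        simp [wdzbar, ← hd1, ← hd2] at this
        linarith
      have hi : d1.im + d2.re = -2 * S.im := by
        have := congrArg Complex.im hpde'
        simp [wdzbar, ← hd1, ← hd2] at this
        linarith
      have hSV : e • S = ∑ k, a k j z * V k z := by
        rw [hS, Finset.smul_sum]
        exact Finset.sum_congr rfl fun k _ => by rw [hVin k z hzb, mul_smul_comm]
      have hbound : ‖e • S‖ ^ 2 ≤ K ^ 2 * m * ∑ k, N k z := by
        have h1 : ‖e • S‖ ≤ K * ∑ k, ‖V k z‖ := by
          rw [hSV, Finset.mul_sum]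
          refine (norm_sum_le _ _).trans (Finset.sum_le_sum fun k _ => ?_)
          rw [norm_mul]
          exact mul_le_mul_of_nonneg_right (hK k j z hzb) (norm_nonneg _)
        have h2 : (∑ k, ‖V k z‖) ^ 2 ≤ m * ∑ k, ‖V k z‖ ^ 2 := by
          simpa using sq_sum_le_card_mul_sum_sq (s := Finset.univ) (f := fun k => ‖V k z‖)
        simp only [hNnorm]
        calc ‖e • S‖ ^ 2 ≤ (K * ∑ k, ‖V k z‖) ^ 2 := pow_le_pow_left₀ (norm_nonneg _) h1 2
          _ = K ^ 2 * (∑ k, ‖V k z‖) ^ 2 := mul_pow _ _ _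
          _ ≤ K ^ 2 * (m * ∑ k, ‖V k z‖ ^ 2) := mul_le_mul_of_nonneg_left h2 (sq_nonneg K)
          _ = _ := by ring
      rw [hd, hd, hd, hd]
      rw [hVin j z hzb]
      simp only [map_smul, Complex.reCLM_apply, Complex.imCLM_apply, smul_eq_mul, Complex.one_re,
        Complex.one_im, Complex.I_re, Complex.I_im, ← he, ← hd1, ← hd2]
      calc _ = (e * (d1.re - d2.im)) ^ 2 + (e * (d1.im + d2.re)) ^ 2 := by ring
        _ = 4 * ‖e • S‖ ^ 2 := by
          rw [hr, hi, ← Complex.normSq_eq_norm_sq, Complex.normSq_apply, Complex.smul_re,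
            Complex.smul_im, smul_eq_mul, smul_eq_mul]
          ring
        _ ≤ _ := by linarith
    · exact absurd (by simpa using hz1) hz
    · refine le_trans (le_of_eq ?_) hRHS
      rw [lineDeriv_eq_zero_off_closedBall (hp0 j) hz1,
        lineDeriv_eq_zero_off_closedBall (hp0 j) hz1,
        lineDeriv_eq_zero_off_closedBall (hq0 j) hz1,
        lineDeriv_eq_zero_off_closedBall (hq0 j) hz1, hp0 j z hz1.le, hq0 j z hz1.le]
      ring
  have htotal := Finset.sum_le_sum fun j (_ : j ∈ Finset.univ) => hineq j
  rw [← Finset.mul_sum, Finset.sum_const, integral_const_mul,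
    integral_finsetSum _ fun k _ => hNint k, Finset.card_univ, Fintype.card_fin,
    nsmul_eq_mul] at htotal
  have hNnn : ∀ j, 0 ≤ ∫ z, N j z := fun j =>
    integral_nonneg fun z => by rw [hNnorm]; exact sq_nonneg _
  have hsum0 : ∑ j, ∫ z, N j z = 0 := by
    have h0 : 0 ≤ ∑ j, ∫ z, N j z := Finset.sum_nonneg fun j _ => hNnn j
    have h1 : 0 ≤ K ^ 2 * m ^ 2 * ∑ j, ∫ z, N j z := by positivity
    rw [hs] at htotal
    nlinarith
  intro j z hz
  have hj : ∫ z, N j z = 0 :=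
    (Finset.sum_eq_zero_iff_of_nonneg fun j _ => hNnn j).1 hsum0 j (Finset.mem_univ j)
  have hNcont : Continuous (N j) :=
    ((hp j).continuous.mul (hp j).continuous).add ((hq j).continuous.mul (hq j).continuous)
  have hae := (integral_eq_zero_iff_of_nonneg
    (fun z => by rw [hNnorm]; exact sq_nonneg _) (hNint j)).1 hj
  have hNz : N j z = 0 := congrFun ((hNcont.ae_eq_iff_eq volume continuous_const).1 hae) z
  rw [hNnorm, sq_eq_zero_iff, norm_eq_zero, hVin j z hz] at hNz
  exact (smul_eq_zero.1 hNz).resolve_left (Real.exp_pos _).ne'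
end

section
/- Let f : D̄ → ℂ be C¹ with |∂f/∂z̄| ≤ C|f| on D for some constant C, and f = 0 on ∂D. Then f ≡ 0 on D. -/
open Metric

open Complex MeasureTheory Set Filter Topology

/-- A real-linear endomorphism of `ℂ` is determined by its values at `1` and `I`. -/
lemma realLinear_apply_eq (L : ℂ →L[ℝ] ℂ) (v : ℂ) :
    L v = (v.re : ℂ) * L 1 + (v.im : ℂ) * L I := by
  have hv : v = v.re • (1 : ℂ) + v.im • I := by
    rw [real_smul, real_smul, mul_one]
    exact (re_add_im v).symm
  conv_lhs => rw [hv]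
  rw [map_add, map_smul, map_smul, real_smul, real_smul]

/-- The antilinear part of a real-linear map, evaluated in a rotated frame. -/
lemma realLinear_apply_add_I_mul (L : ℂ →L[ℝ] ℂ) (v : ℂ) :
    L v + I * L (I * v) = (starRingEnd ℂ) v * (L 1 + I * L I) := by
  rw [realLinear_apply_eq L v, realLinear_apply_eq L (I * v)]
  have hc : (starRingEnd ℂ) v = v.re - v.im * I := by
    apply Complex.ext <;> simp
  rw [hc]
  simp only [mul_re, mul_im, I_re, I_im, zero_mul, one_mul, zero_sub, zero_add, ofReal_neg]
  linear_combination ((v.im : ℂ) * L I) * I_sq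

/-- A complex-linear real-linear map killing a nonzero vector vanishes. -/
lemma realLinear_eq_zero {L : ℂ →L[ℝ] ℂ} (h : L 1 + I * L I = 0) {v : ℂ} (hv : v ≠ 0)
    (hLv : L v = 0) : L = 0 := by
  have hI : L I = I * L 1 := by
    linear_combination (-I) * h + L I * I_sq
  have hlin (w : ℂ) : L w = w * L 1 := by
    rw [realLinear_apply_eq L w, hI]
    conv_rhs => rw [← re_add_im w]
    ring
  have h1 : L 1 = 0 := by
    rw [hlin] at hLv
    exact (mul_eq_zero.1 hLv).resolve_left hv
  ext w
  rw [hlin, h1, mul_zero, zero_apply]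

lemma wdzbar_def_mul (f : ℂ → ℂ) (z : ℂ) :
    wdzbar f z = (1 / 2) * (fderiv ℝ f z 1 + I * fderiv ℝ f z I) := rfl

lemma wdzbar_mul_holomorphic {f h : ℂ → ℂ} {z h' : ℂ} (hf : DifferentiableAt ℝ f z)
    (hh : HasDerivAt h h' z) : wdzbar (fun w => f w * h w) z = wdzbar f z * h z := by
  have hd : HasFDerivAt (fun w => f w * h w) _ z :=
    hf.hasFDerivAt.mul (hh.hasFDerivAt.restrictScalars ℝ)
  rw [wdzbar_def_mul, wdzbar_def_mul, hd.fderiv]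
  simp
  linear_combination (1 / 2 * f z * h') * I_sq

/-- The integral of the radial derivative over a circle is controlled by `∂_z̄`. -/
lemma integral_radial_fderiv {g : ℂ → ℂ} (hg : ContDiff ℝ 1 g) (z : ℂ) {r : ℝ} (hr : r ≠ 0) :
    ∫ θ in (0 : ℝ)..2 * Real.pi, fderiv ℝ g (circleMap z r θ) (circleMap 0 1 θ) =
      ∫ θ in (0 : ℝ)..2 * Real.pi,
        2 * (starRingEnd ℂ) (circleMap 0 1 θ) * wdzbar g (circleMap z r θ) := by
  have hD : Continuous (fderiv ℝ g) := hg.continuous_fderiv (by norm_num)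
  have hc1 : Continuous fun θ : ℝ =>
      fderiv ℝ g (circleMap z r θ) (circleMap 0 1 θ) := by fun_prop
  have hc2 : Continuous fun θ : ℝ =>
      fderiv ℝ g (circleMap z r θ) (I * circleMap 0 1 θ) := by fun_prop
  have hder (θ : ℝ) : HasDerivAt (fun t : ℝ => g (circleMap z r t))
      ((r : ℂ) * fderiv ℝ g (circleMap z r θ) (I * circleMap 0 1 θ)) θ := by
    have h := ((hg.differentiable (by norm_num)).differentiableAt.hasFDerivAt
      (x := circleMap z r θ)).comp_hasDerivAt θ (hasDerivAt_circleMap z r θ)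
    refine h.congr_deriv ?_
    rw [← real_smul, ← map_smul, real_smul]
    congr 1
    simp only [circleMap]
    push_cast
    ring
  have htan : ∫ θ in (0 : ℝ)..2 * Real.pi,
      fderiv ℝ g (circleMap z r θ) (I * circleMap 0 1 θ) = 0 := by
    have h := intervalIntegral.integral_eq_sub_of_hasDerivAt (a := 0) (b := 2 * Real.pi)
      (fun θ _ => hder θ) ((continuous_const.mul hc2).intervalIntegrable _ _)
    rw [intervalIntegral.integral_const_mul] at h
    have hper : g (circleMap z r (2 * Real.pi)) - g (circleMap z r 0) = 0 := by
      simp [circleMap]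
    rw [hper] at h
    exact (mul_eq_zero.1 h).resolve_left (by exact_mod_cast hr)
  have hsum := intervalIntegral.integral_add (hc1.intervalIntegrable 0 (2 * Real.pi) (μ := volume))
    (hc2.const_mul I |>.intervalIntegrable 0 (2 * Real.pi))
  rw [intervalIntegral.integral_const_mul, htan, mul_zero, add_zero] at hsum
  rw [← hsum]
  refine intervalIntegral.integral_congr fun θ _ => ?_
  simp only [realLinear_apply_add_I_mul, wdzbar_def_mul]
  ring

/-- A radial form of the Cauchy-Pompeiu estimate. -/
lemma norm_le_integral_of_wdzbar_le {g : ℂ → ℂ} (hg : ContDiff ℝ 1 g) {z : ℂ} {R : ℝ}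
    (hR : 0 ≤ R) (hzero : ∀ w, ‖w - z‖ = R → g w = 0) {B : ℝ → ℝ} (hB : Continuous B)
    (hbound : ∀ w, ‖wdzbar g w‖ ≤ B ‖w - z‖) :
    ‖g z‖ ≤ 2 * ∫ r in (0 : ℝ)..R, B r := by
  have hD : Continuous (fderiv ℝ g) := hg.continuous_fderiv (by norm_num)
  have hjoint : Continuous fun p : ℝ × ℝ =>
      fderiv ℝ g (circleMap z p.1 p.2) (circleMap 0 1 p.2) := by
    simp only [circleMap]
    fun_prop
  have hray (θ : ℝ) :
      ∫ r in (0 : ℝ)..R, fderiv ℝ g (circleMap z r θ) (circleMap 0 1 θ) = - g z := by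
    have hder (r : ℝ) : HasDerivAt (fun t : ℝ => g (circleMap z t θ))
        (fderiv ℝ g (circleMap z r θ) (circleMap 0 1 θ)) r := by
      refine ((hg.differentiable (by norm_num)).differentiableAt.hasFDerivAt
        (x := circleMap z r θ)).comp_hasDerivAt r ?_
      simpa [circleMap] using
        ((hasDerivAt_id r).ofReal_comp.mul_const (exp (θ * I))).const_add z
    rw [intervalIntegral.integral_eq_sub_of_hasDerivAt (fun r _ => hder r)
      (Continuous.intervalIntegrable (hjoint.comp (by fun_prop : Continuous fun r => (r, θ))) _ _),
      hzero _ (by simp [circleMap, norm_exp_ofReal_mul_I, abs_of_nonneg hR])]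
    simp [circleMap]
  have hswap := intervalIntegral_intervalIntegral_swap (a := 0) (b := R) (c := 0)
    (d := 2 * Real.pi) (F := fun r θ => fderiv ℝ g (circleMap z r θ) (circleMap 0 1 θ))
    (by
      exact (hjoint.continuousOn.integrableOn_compact
        (isCompact_uIcc.prod isCompact_uIcc)).mono_set
          (prod_mono uIoc_subset_uIcc uIoc_subset_uIcc))
  simp only [hray, intervalIntegral.integral_const] at hswap
  have hle : ‖(2 * Real.pi - 0) • -g z‖ ≤ ∫ r in (0 : ℝ)..R, 2 * B r * (2 * Real.pi) := by
    rw [← hswap]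
    refine intervalIntegral.norm_integral_le_of_norm_le hR
      (Eventually.of_forall fun r hr => ?_) (Continuous.intervalIntegrable (by fun_prop) _ _)
    rw [integral_radial_fderiv hg z hr.1.ne']
    refine (intervalIntegral.norm_integral_le_of_norm_le_const (C := 2 * B r)
      fun θ _ => ?_).trans_eq ?_
    · have h := hbound (circleMap z r θ)
      have hn : ‖circleMap z r θ - z‖ = r := by
        simp [circleMap, norm_exp_ofReal_mul_I, abs_of_pos hr.1]
      rw [hn] at h
      simpa [circleMap, norm_exp_ofReal_mul_I] using h
    · rw [sub_zero, abs_of_pos Real.two_pi_pos]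
  rw [intervalIntegral.integral_mul_const, intervalIntegral.integral_const_mul, norm_smul,
    norm_neg, sub_zero, Real.norm_eq_abs, abs_of_pos Real.two_pi_pos, mul_comm] at hle
  exact le_of_mul_le_mul_right hle Real.two_pi_pos

/-- The Gaussian weight makes the Cauchy-Pompeiu kernel small. -/
lemma norm_exp_conj_mul_sub (b : ℝ) (z w : ℂ) :
    ‖exp (2 * b * (starRingEnd ℂ) z * (w - z))‖ =
      Real.exp (b * ‖w‖ ^ 2) * Real.exp (-(b * ‖z‖ ^ 2)) * Real.exp (-b * ‖w - z‖ ^ 2) := by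
  rw [norm_exp, ← Real.exp_add, ← Real.exp_add]
  congr 1
  simp only [← normSq_eq_norm_sq, normSq_apply]
  simp
  ring

lemma intervalIntegral_gaussian_le {b R : ℝ} (hb : 0 < b) (hR : 0 ≤ R) :
    ∫ r in (0 : ℝ)..R, Real.exp (-b * r ^ 2) ≤ √(Real.pi / b) / 2 := by
  rw [← integral_gaussian_Ioi, intervalIntegral.integral_of_le hR]
  exact setIntegral_mono_set (integrable_exp_neg_mul_sq hb).integrableOn
    (Eventually.of_forall fun _ => (Real.exp_pos _).le) Ioc_subset_Ioi_self.eventuallyLE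

/-- A compactly supported pseudo-holomorphic function vanishes identically. -/
lemma eq_zero_of_wdzbar_le {F : ℂ → ℂ} {C : ℝ} (hF : ContDiff ℝ 1 F) (hC : 0 ≤ C)
    (hineq : ∀ z, ‖wdzbar F z‖ ≤ C * ‖F z‖) (hsupp : ∀ z, 1 < ‖z‖ → F z = 0) (z : ℂ) :
    F z = 0 := by
  obtain ⟨b, hb, hCb⟩ : ∃ b : ℝ, 0 < b ∧ C * √(Real.pi / b) < 1 := by
    have hpos : 0 < Real.pi * C ^ 2 + 1 := by positivity
    refine ⟨Real.pi * C ^ 2 + 1, hpos, ?_⟩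
    have hsq : C ^ 2 * (Real.pi / (Real.pi * C ^ 2 + 1)) < 1 := by
      rw [← mul_div_assoc, div_lt_one hpos]
      linarith
    refine lt_of_pow_lt_pow_left₀ 2 zero_le_one ?_
    rwa [mul_pow, Real.sq_sqrt (by positivity), one_pow]
  set G : ℂ → ℝ := fun w => ‖F w‖ * Real.exp (b * ‖w‖ ^ 2) with hG
  have hGc : Continuous G := by
    have := hF.continuous
    fun_prop
  obtain ⟨p, hp, hmax⟩ := (isCompact_closedBall (0 : ℂ) 1).exists_isMaxOn
    ⟨0, by simp⟩ hGc.continuousOn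
  have hpn : ‖p‖ ≤ 1 := by simpa using hp
  have hGle (w : ℂ) : G w ≤ G p := by
    by_cases hw : ‖w‖ ≤ 1
    · exact hmax (by simpa using hw)
    · rw [hG]
      simp only [hsupp w (not_le.1 hw), norm_zero, zero_mul]
      positivity
  have hGp : G p ≤ 0 := by
    set h : ℂ → ℂ := fun w => exp (2 * b * (starRingEnd ℂ) p * (w - p)) with hh
    have hhd (w : ℂ) : HasDerivAt h
        (exp (2 * b * (starRingEnd ℂ) p * (w - p)) * (2 * b * (starRingEnd ℂ) p)) w := by
      simpa using (((hasDerivAt_id w).sub_const p).const_mul (2 * b * (starRingEnd ℂ) p)).cexp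
    have hhc : ContDiff ℝ 1 h := by
      fun_prop
    have key := norm_le_integral_of_wdzbar_le (hF.mul hhc) (z := p) (R := 3) (by norm_num)
      (fun w hw => by
        have : ‖w - p‖ ≤ ‖w‖ + ‖p‖ := norm_sub_le w p
        rw [hsupp w (by linarith), zero_mul])
      (B := fun r => C * (G p * Real.exp (-(b * ‖p‖ ^ 2))) * Real.exp (-b * r ^ 2))
      (by fun_prop)
      (fun w => by
        rw [wdzbar_mul_holomorphic (hF.differentiable (by norm_num)).differentiableAt (hhd w),
          norm_mul, norm_exp_conj_mul_sub]
        calc ‖wdzbar F w‖ * (Real.exp (b * ‖w‖ ^ 2) * Real.exp (-(b * ‖p‖ ^ 2)) *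
              Real.exp (-b * ‖w - p‖ ^ 2))
            ≤ C * ‖F w‖ * (Real.exp (b * ‖w‖ ^ 2) * Real.exp (-(b * ‖p‖ ^ 2)) *
              Real.exp (-b * ‖w - p‖ ^ 2)) := by
              gcongr
              exact hineq w
          _ = C * (G w * Real.exp (-(b * ‖p‖ ^ 2))) * Real.exp (-b * ‖w - p‖ ^ 2) := by
              simp only [hG]
              ring
          _ ≤ _ := by
              gcongr
              exact hGle w)
    have hFp : ‖F p * h p‖ = G p * Real.exp (-(b * ‖p‖ ^ 2)) := by
      simp [hh, hG, mul_assoc, ← Real.exp_add]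
    rw [hFp, intervalIntegral.integral_const_mul] at key
    set m := G p * Real.exp (-(b * ‖p‖ ^ 2)) with hm
    have hm0 : 0 ≤ m := by positivity
    have hint := intervalIntegral_gaussian_le hb (R := 3) (by norm_num)
    have hle : m ≤ m * (C * √(Real.pi / b)) := by
      calc m ≤ 2 * (C * m * ∫ r in (0 : ℝ)..3, Real.exp (-b * r ^ 2)) := key
        _ ≤ 2 * (C * m * (√(Real.pi / b) / 2)) := by gcongr
        _ = _ := by ring
    have hm1 : m ≤ 0 := by nlinarith
    exact nonpos_of_mul_nonpos_left hm1 (Real.exp_pos _)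
  have hz : ‖F z‖ ≤ 0 := nonpos_of_mul_nonpos_left ((hGle z).trans hGp) (Real.exp_pos _)
  simpa using hz

/-- The derivative of `f` vanishes on the boundary circle. -/
lemma fderivWithin_eq_zero_on_circle {f : ℂ → ℂ} {C : ℝ}
    (hf : ContDiffOn ℝ 1 f (closedBall 0 1))
    (hineq : ∀ z ∈ ball (0 : ℂ) 1, ‖wdzbar f z‖ ≤ C * ‖f z‖)
    (hbd : ∀ z : ℂ, ‖z‖ = 1 → f z = 0) {p : ℂ} (hp : ‖p‖ = 1) :
    fderivWithin ℝ f (closedBall 0 1) p = 0 := by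
  have hu : UniqueDiffOn ℝ (closedBall (0 : ℂ) 1) :=
    uniqueDiffOn_convex (convex_closedBall 0 1) ⟨0, by simp [interior_closedBall]⟩
  have hD := hf.continuousOn_fderivWithin hu le_rfl
  have hpK : p ∈ closedBall (0 : ℂ) 1 := by simp [hp]
  have hcl : closure (ball (0 : ℂ) 1) = closedBall 0 1 := closure_ball 0 one_ne_zero
  have hle := le_on_closure (s := ball (0 : ℂ) 1) (x := p)
    (f := fun z => ‖(1 / 2 : ℂ) * (fderivWithin ℝ f (closedBall 0 1) z 1 +
      I * fderivWithin ℝ f (closedBall 0 1) z I)‖) (g := fun z => C * ‖f z‖)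
    (fun z hz => by
      have h := hineq z hz
      rw [wdzbar_def_mul] at h
      simpa only [fderivWithin_of_mem_nhds
        (mem_of_superset (isOpen_ball.mem_nhds hz) ball_subset_closedBall)] using h)
    (by rw [hcl]; fun_prop)
    (by rw [hcl]; exact continuousOn_const.mul hf.continuousOn.norm)
    (by rwa [hcl])
  have hbar : fderivWithin ℝ f (closedBall 0 1) p 1 +
      I * fderivWithin ℝ f (closedBall 0 1) p I = 0 := by
    simp only [hbd p hp, norm_zero, mul_zero, norm_mul] at hle
    exact norm_le_zero_iff.1 (nonpos_of_mul_nonpos_right hle (by norm_num))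
  obtain ⟨θ, rfl⟩ : ∃ θ : ℝ, circleMap 0 1 θ = p := by
    have : p ∈ sphere (0 : ℂ) |1| := by simp [hp]
    rwa [← range_circleMap] at this
  have htan := ((hf.differentiableOn (by norm_num)) _ hpK).hasFDerivWithinAt.comp_hasDerivAt θ
    (hasDerivAt_circleMap 0 1 θ) (Eventually.of_forall fun t => by simp [circleMap])
  have hconst : f ∘ circleMap 0 1 = fun _ => (0 : ℂ) := by
    funext t
    exact hbd _ (by simp)
  rw [hconst] at htan
  exact realLinear_eq_zero hbar (v := circleMap 0 1 θ * I)
    (mul_ne_zero (circleMap_ne_center one_ne_zero) I_ne_zero)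
    (htan.unique (hasDerivAt_const θ 0))

/-- Extension by zero across the circle, when both `f` and its derivative vanish there. -/
lemma hasFDerivAt_piecewise_zero {f : ℂ → ℂ} {K : Set ℂ} [∀ z, Decidable (z ∈ K)]
    (hK : IsClosed K) (hf : DifferentiableOn ℝ f K)
    (h0 : ∀ z ∈ frontier K, f z = 0 ∧ fderivWithin ℝ f K z = 0) (z : ℂ) :
    HasFDerivAt (K.piecewise f 0) (K.piecewise (fderivWithin ℝ f K) 0 z) z := by
  have hin (hz : z ∈ K) : HasFDerivWithinAt (K.piecewise f 0) (fderivWithin ℝ f K z) K z :=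
    (hf z hz).hasFDerivWithinAt.congr (fun w hw => piecewise_eq_of_mem _ _ _ hw)
      (piecewise_eq_of_mem _ _ _ hz)
  by_cases hz : z ∈ K
  · rw [piecewise_eq_of_mem _ _ _ hz]
    by_cases hfr : z ∈ frontier K
    · have hout : HasFDerivWithinAt (K.piecewise f 0) (fderivWithin ℝ f K z) Kᶜ z := by
        rw [(h0 z hfr).2]
        refine (hasFDerivWithinAt_const (0 : ℂ) z Kᶜ).congr
          (fun w hw => piecewise_eq_of_notMem _ _ _ hw) ?_
        rw [piecewise_eq_of_mem _ _ _ hz, (h0 z hfr).1]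
      have := (hin hz).union hout
      rwa [union_compl_self, hasFDerivWithinAt_univ] at this
    · refine (hin hz).hasFDerivAt (mem_interior_iff_mem_nhds.1 ?_)
      by_contra hi
      exact hfr ⟨subset_closure hz, hi⟩
  · rw [piecewise_eq_of_notMem _ _ _ hz]
    refine (hasFDerivAt_const (0 : ℂ) z).congr_of_eventuallyEq ?_
    filter_upwards [hK.isOpen_compl.mem_nhds hz] with w hw
    exact piecewise_eq_of_notMem _ _ _ hw

/-- Unique continuation for pseudo-holomorphic functions with zero boundary values:
if `f` is `C¹` on the closed unit disk, `|∂f/∂z̄| ≤ C|f|` on the open disk, and `f = 0`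
on the boundary circle, then `f ≡ 0` on the disk. -/
theorem pseudoholomorphic_zero_boundary_zero (f : ℂ → ℂ) (C : ℝ)
    (hf : ContDiffOn ℝ 1 f (closedBall 0 1))
    (hineq : ∀ z ∈ ball (0 : ℂ) 1, ‖wdzbar f z‖ ≤ C * ‖f z‖)
    (hbd : ∀ z : ℂ, ‖z‖ = 1 → f z = 0) :
    ∀ z ∈ ball (0 : ℂ) 1, f z = 0 := by
  classical
  intro z hz
  set K := closedBall (0 : ℂ) 1 with hK
  have hu : UniqueDiffOn ℝ K :=
    uniqueDiffOn_convex (convex_closedBall 0 1) ⟨0, by simp [hK, interior_closedBall]⟩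
  have h0 (w : ℂ) (hw : w ∈ frontier K) : f w = 0 ∧ fderivWithin ℝ f K w = 0 := by
    have hw1 : ‖w‖ = 1 := by simpa using frontier_closedBall_subset_sphere hw
    exact ⟨hbd w hw1, fderivWithin_eq_zero_on_circle hf hineq hbd hw1⟩
  have hder := hasFDerivAt_piecewise_zero isClosed_closedBall
    (hf.differentiableOn (by norm_num)) h0
  have hDc : Continuous (K.piecewise (fderivWithin ℝ f K) 0) := by
    refine continuous_piecewise (fun w hw => (h0 w hw).2) ?_ continuousOn_const
    rw [isClosed_closedBall.closure_eq]
    exact hf.continuousOn_fderivWithin hu le_rfl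
  have hF : ContDiff ℝ 1 (K.piecewise f 0) := contDiff_one_iff_hasFDerivAt.2 ⟨_, hDc, hder⟩
  have hFineq (w : ℂ) : ‖wdzbar (K.piecewise f 0) w‖ ≤ |C| * ‖K.piecewise f 0 w‖ := by
    by_cases hw : w ∈ ball (0 : ℂ) 1
    · have hwK : w ∈ K := ball_subset_closedBall hw
      have heq : fderiv ℝ (K.piecewise f 0) w = fderiv ℝ f w := by
        rw [(hder w).fderiv, piecewise_eq_of_mem _ _ _ hwK, fderivWithin_of_mem_nhds
          (mem_of_superset (isOpen_ball.mem_nhds hw) ball_subset_closedBall)]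
      rw [wdzbar, heq, piecewise_eq_of_mem _ _ _ hwK]
      exact (hineq w hw).trans (by gcongr; exact le_abs_self C)
    · have hzero : fderiv ℝ (K.piecewise f 0) w = 0 := by
        rw [(hder w).fderiv]
        by_cases hwK : w ∈ K
        · rw [piecewise_eq_of_mem _ _ _ hwK]
          have h1 : ‖w‖ ≤ 1 := by simpa [hK] using hwK
          have h2 : 1 ≤ ‖w‖ := by simpa using hw
          exact fderivWithin_eq_zero_on_circle hf hineq hbd (le_antisymm h1 h2)
        · rw [piecewise_eq_of_notMem _ _ _ hwK, Pi.zero_apply]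
      rw [wdzbar_def_mul, hzero]
      simp only [zero_apply, mul_zero, add_zero, norm_zero]
      positivity
  have hFz := eq_zero_of_wdzbar_le hF (abs_nonneg C) hFineq
    (fun w hw => piecewise_eq_of_notMem _ _ _ (by simpa [hK] using hw)) z
  rwa [piecewise_eq_of_mem _ _ _ (ball_subset_closedBall hz)] at hFz
end
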